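/- Let G be a connected weighted graph with positive edge weights and let 𝒞 be a stretch-friendly partition of V(G) in which every cluster has a rooted spanning tree of radius at most r; let T_C denote the edge set of the tree of cluster C. For each pair of distinct clusters C, C' joined by at least one edge of G, let e_{C,C'} be a minimum-weight edge of G between C and C', and let H be the weighted graph on vertex set 𝒞 with an edge {C,C'} of weight w(e_{C,C'}) for every such pair. If F ⊆ E(H) is (the edge set of) an α-spanner of H, then the subgraph of G with edge set (⋃_{C∈𝒞} T_C) ∪ {e_{C,C'} : {C,C'} ∈ F} is a ((2r+1)(α+1)−1)-spanner of G. -/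

import Mathlib

open SimpleGraph

/-- A cluster of a graph `G`: a set `carrier` of vertices together with a rooted spanning
tree of the cluster consisting of edges of `G`. -/
structure RootedCluster {V : Type*} (G : SimpleGraph V) where
  carrier : Set V
  tree : SimpleGraph V
  root : V
  root_mem : root ∈ carrier
  tree_le : tree ≤ G
  mem_of_adj : ∀ u v : V, tree.Adj u v → u ∈ carrier ∧ v ∈ carrier
  reach : ∀ v ∈ carrier, tree.Reachable v root
  acyclic : tree.IsAcyclic

/-- The rooted tree of the cluster has radius at most `r`: every vertex of the cluster is
joined to the root by a tree path with at most `r` edges. -/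
def RootedCluster.RadiusLE {V : Type*} {G : SimpleGraph V} (K : RootedCluster G)
    (r : ℕ) : Prop :=
  ∀ v ∈ K.carrier, ∃ p : K.tree.Walk v K.root, p.length ≤ r

/-- A cluster is stretch-friendly: for every boundary edge `{u, v}` (with `v` inside,
`u` outside) every edge on the tree path from `v` to the root weighs at most `w s(u, v)`,
and for every inside edge `{u, v}` every edge on the tree path between `u` and `v` weighs
at most `w s(u, v)`. -/
def RootedCluster.StretchFriendly {V : Type*} {G : SimpleGraph V} (K : RootedCluster G)
    (w : Sym2 V → NNReal) : Prop :=
  (∀ u v : V, G.Adj u v → v ∈ K.carrier → u ∉ K.carrier →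
    ∀ p : K.tree.Path v K.root, ∀ e ∈ p.1.edges, w e ≤ w s(u, v)) ∧
  (∀ u v : V, G.Adj u v → u ∈ K.carrier → v ∈ K.carrier →
    ∀ p : K.tree.Path u v, ∀ e ∈ p.1.edges, w e ≤ w s(u, v))
/-- Weighted shortest-path distance in a graph `G` with edge weights `w`
(`⊤` if `u` and `v` are not connected). -/
noncomputable def wdist {V : Type*} (G : SimpleGraph V) (w : Sym2 V → NNReal) (u v : V) :
    ENNReal :=
  ⨅ p : G.Walk u v, ((p.edges.map w).sum : ENNReal)

/-- `H` is an `α`-spanner of the weighted graph `(G, w)`. -/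
def IsSpanner {V : Type*} (G H : SimpleGraph V) (w : Sym2 V → NNReal) (α : ℝ) : Prop :=
  H ≤ G ∧ ∀ u v : V, wdist H w u v ≤ ENNReal.ofReal α * wdist G w u v

theorem wdist_le_walk {V : Type*} {G : SimpleGraph V} (w : Sym2 V → NNReal) {u v : V}
    (p : G.Walk u v) : wdist G w u v ≤ ((p.edges.map w).sum : ENNReal) :=
  iInf_le _ p

theorem wdist_self {V : Type*} (G : SimpleGraph V) (w : Sym2 V → NNReal) (u : V) :
    wdist G w u u = 0 :=
  le_antisymm (by simpa using wdist_le_walk w (Walk.nil : G.Walk u u)) zero_le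

theorem wdist_comm_le {V : Type*} (G : SimpleGraph V) (w : Sym2 V → NNReal) (u v : V) :
    wdist G w u v ≤ wdist G w v u :=
  le_iInf fun p => by simpa [List.sum_reverse] using wdist_le_walk w p.reverse

theorem wdist_comm {V : Type*} (G : SimpleGraph V) (w : Sym2 V → NNReal) (u v : V) :
    wdist G w u v = wdist G w v u :=
  le_antisymm (wdist_comm_le G w u v) (wdist_comm_le G w v u)

theorem wdist_triangle {V : Type*} (G : SimpleGraph V) (w : Sym2 V → NNReal) (u v x : V) :
    wdist G w u x ≤ wdist G w u v + wdist G w v x :=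
  ENNReal.le_iInf_add_iInf fun p q => by simpa using wdist_le_walk w (p.append q)

theorem wdist_le_of_adj {V : Type*} {G : SimpleGraph V} (w : Sym2 V → NNReal) {u v : V}
    (h : G.Adj u v) : wdist G w u v ≤ w s(u, v) := by
  simpa using wdist_le_walk w h.toWalk

theorem wdist_anti {V : Type*} {G G' : SimpleGraph V} (h : G ≤ G') (w : Sym2 V → NNReal)
    (u v : V) : wdist G' w u v ≤ wdist G w u v :=
  le_iInf fun p => by simpa using wdist_le_walk w (p.mapLe h)

/-- A walk with at most `m` edges, each of weight at most `x`, bounds the distance by `m * x`. -/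
theorem wdist_le_of_length_le {V : Type*} {G : SimpleGraph V} {w : Sym2 V → NNReal} {u v : V}
    (p : G.Walk u v) {m : ℕ} (hm : p.length ≤ m) {x : NNReal} (hx : ∀ e ∈ p.edges, w e ≤ x) :
    wdist G w u v ≤ m * (x : ENNReal) := by
  refine (wdist_le_walk w p).trans ?_
  have h := List.sum_le_card_nsmul (p.edges.map w) x (by simpa using hx)
  rw [List.length_map, Walk.length_edges, nsmul_eq_mul] at h
  have hsum : (p.edges.map w).sum ≤ (m : NNReal) * x := h.trans (by gcongr)
  exact_mod_cast hsum

/-- A uniform stretch bound on edges gives the same stretch bound on all distances. -/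
theorem wdist_le_mul_of_adj {V W : Type*} {G : SimpleGraph V} {S : SimpleGraph W}
    {w : Sym2 V → NNReal} {w' : Sym2 W → NNReal} (f : V → W) {c : ENNReal} (hc₀ : c ≠ 0)
    (hc : c ≠ ⊤)
    (h : ∀ u v, G.Adj u v → wdist S w' (f u) (f v) ≤ c * (w s(u, v) : ENNReal)) (u v : V) :
    wdist S w' (f u) (f v) ≤ c * wdist G w u v := by
  rw [wdist, wdist, ENNReal.mul_iInf_of_ne hc₀ hc]
  refine le_iInf fun p => ?_
  change wdist S w' (f u) (f v) ≤ _
  induction p with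
  | nil => simp [wdist_self]
  | @cons a b d hab q ih =>
    refine (wdist_triangle S w' (f a) (f b) (f d)).trans ?_
    simpa [mul_add] using add_le_add (h a b hab) ih

namespace RootedCluster

variable {V : Type*} {G : SimpleGraph V} {K : RootedCluster G} {w : Sym2 V → NNReal} {r : ℕ}

theorem StretchFriendly.wdist_root_le (hK : K.StretchFriendly w) (hr : K.RadiusLE r) {u v : V}
    (huv : G.Adj u v) (hv : v ∈ K.carrier) (hu : u ∉ K.carrier) :
    wdist K.tree w v K.root ≤ r * (w s(u, v) : ENNReal) := by
  classical
  obtain ⟨p, hp⟩ := hr v hv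
  exact wdist_le_of_length_le p.bypass (p.length_bypass_le_length.trans hp)
    (hK.1 u v huv hv hu p.toPath)

theorem StretchFriendly.wdist_le_of_mem (hK : K.StretchFriendly w) (hr : K.RadiusLE r) {u v : V}
    (huv : G.Adj u v) (hu : u ∈ K.carrier) (hv : v ∈ K.carrier) :
    wdist K.tree w u v ≤ (2 * r : ℕ) * (w s(u, v) : ENNReal) := by
  classical
  obtain ⟨p, hp⟩ := hr u hu
  obtain ⟨q, hq⟩ := hr v hv
  refine wdist_le_of_length_le (p.append q.reverse).bypass
    ((Walk.length_bypass_le_length _).trans ?_) (hK.2 u v huv hu hv (p.append q.reverse).toPath)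
  rw [Walk.length_append, Walk.length_reverse]
  omega

end RootedCluster

/-- lifting a spanner of the cluster graph of a stretch-friendly partition
(with clusters of radius at most `r`) through the cluster trees and the chosen
minimum-weight inter-cluster edges yields a `((2r+1)(α+1)-1)`-spanner of `G`. -/
theorem spanner_of_clusterGraph_spanner {n : ℕ} (G : SimpleGraph (Fin n))
    (w : Sym2 (Fin n) → NNReal) (hG : G.Connected) (hw : ∀ e ∈ G.edgeSet, 0 < w e)
    (r : ℕ) (𝒞 : Set (RootedCluster G))
    (hdisj : 𝒞.Pairwise fun K₁ K₂ => Disjoint K₁.carrier K₂.carrier)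
    (hcover : (⋃ K ∈ 𝒞, K.carrier) = Set.univ)
    (hsf : ∀ K ∈ 𝒞, K.StretchFriendly w)
    (hrad : ∀ K ∈ 𝒞, K.RadiusLE r)
    -- the cluster graph `H` on the clusters, with one vertex per cluster and an edge
    -- between any two distinct clusters joined by at least one edge of `G`
    (H : SimpleGraph 𝒞)
    (hH : ∀ K₁ K₂ : 𝒞, H.Adj K₁ K₂ ↔ (K₁ ≠ K₂ ∧
      ∃ u v : Fin n, G.Adj u v ∧ u ∈ K₁.1.carrier ∧ v ∈ K₂.1.carrier))
    -- a choice `e K₁ K₂` of a minimum-weight edge of `G` between adjacent clusters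
    (e : 𝒞 → 𝒞 → Sym2 (Fin n))
    (hesymm : ∀ K₁ K₂ : 𝒞, H.Adj K₁ K₂ → e K₁ K₂ = e K₂ K₁)
    (hemem : ∀ K₁ K₂ : 𝒞, H.Adj K₁ K₂ → ∃ u v : Fin n,
      G.Adj u v ∧ u ∈ K₁.1.carrier ∧ v ∈ K₂.1.carrier ∧ e K₁ K₂ = s(u, v))
    (hemin : ∀ K₁ K₂ : 𝒞, H.Adj K₁ K₂ → ∀ u v : Fin n, G.Adj u v →
      u ∈ K₁.1.carrier → v ∈ K₂.1.carrier → w (e K₁ K₂) ≤ w s(u, v))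
    -- the weight of an edge of the cluster graph is the weight of its chosen edge
    (wH : Sym2 𝒞 → NNReal)
    (hwH : ∀ K₁ K₂ : 𝒞, H.Adj K₁ K₂ → wH s(K₁, K₂) = w (e K₁ K₂))
    -- `F` is an `α`-spanner of the weighted cluster graph
    (α : ℝ) (hα : 1 ≤ α) (F : SimpleGraph 𝒞) (hF : IsSpanner H F wH α) :
    IsSpanner G
      (SimpleGraph.fromEdgeSet
        ((⋃ K ∈ 𝒞, K.tree.edgeSet) ∪ {x | ∃ K₁ K₂ : 𝒞, F.Adj K₁ K₂ ∧ x = e K₁ K₂}))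
      w ((2 * (r : ℝ) + 1) * (α + 1) - 1) := by
  set S : SimpleGraph (Fin n) := SimpleGraph.fromEdgeSet
    ((⋃ K ∈ 𝒞, K.tree.edgeSet) ∪ {x | ∃ K₁ K₂ : 𝒞, F.Adj K₁ K₂ ∧ x = e K₁ K₂}) with hS
  obtain ⟨hFH, hFα⟩ := hF
  have tree_le : ∀ K ∈ 𝒞, K.tree ≤ S := by
    intro K hK a b hab
    rw [hS, SimpleGraph.fromEdgeSet_adj]
    exact ⟨Or.inl (Set.mem_biUnion hK hab), hab.ne⟩
  have notMem : ∀ K₁ K₂ : 𝒞, K₁ ≠ K₂ → ∀ x ∈ K₁.1.carrier, x ∉ K₂.1.carrier :=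
    fun K₁ K₂ hne x h₁ h₂ =>
      Set.disjoint_left.1 (hdisj K₁.2 K₂.2 fun h => hne (Subtype.ext h)) h₁ h₂
  have root_le : ∀ K₁ K₂ : 𝒞, K₁ ≠ K₂ → ∀ u v, G.Adj u v → u ∈ K₁.1.carrier →
      v ∈ K₂.1.carrier → wdist S w u K₁.1.root ≤ r * (w s(u, v) : ENNReal) ∧
        wdist S w v K₂.1.root ≤ r * (w s(u, v) : ENNReal) := by
    intro K₁ K₂ hne u v huv hu hv
    refine ⟨(wdist_anti (tree_le K₁ K₁.2) w _ _).trans ?_,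
      (wdist_anti (tree_le K₂ K₂.2) w _ _).trans
        ((hsf K₂ K₂.2).wdist_root_le (hrad K₂ K₂.2) huv hv (notMem K₁ K₂ hne u hu))⟩
    rw [Sym2.eq_swap]
    exact (hsf K₁ K₁.2).wdist_root_le (hrad K₁ K₁.2) huv.symm hu (notMem K₂ K₁ hne.symm v hv)
  have roots_le : ∀ K₁ K₂ : 𝒞,
      wdist S w K₁.1.root K₂.1.root ≤ (2 * r + 1 : ENNReal) * wdist F wH K₁ K₂ := by
    refine wdist_le_mul_of_adj (fun K : 𝒞 => K.1.root) (by simp) (by finiteness) ?_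
    intro K₁ K₂ hF₁₂
    have hH₁₂ := hFH hF₁₂
    obtain ⟨u, v, huv, hu, hv, he⟩ := hemem K₁ K₂ hH₁₂
    obtain ⟨h₁, h₂⟩ := root_le K₁ K₂ hH₁₂.ne u v huv hu hv
    have hSuv : S.Adj u v := by
      rw [hS, SimpleGraph.fromEdgeSet_adj]
      exact ⟨Or.inr ⟨K₁, K₂, hF₁₂, he.symm⟩, huv.ne⟩
    rw [hwH K₁ K₂ hH₁₂, he]
    calc wdist S w K₁.1.root K₂.1.root
        ≤ wdist S w K₁.1.root u + (wdist S w u v + wdist S w v K₂.1.root) :=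
          (wdist_triangle ..).trans (by gcongr; exact wdist_triangle ..)
      _ ≤ r * (w s(u, v) : ENNReal) + (w s(u, v) + r * (w s(u, v) : ENNReal)) := by
          rw [wdist_comm S w K₁.1.root u]
          gcongr
          exact wdist_le_of_adj w hSuv
      _ = _ := by ring
  have hr₀ : (0 : ℝ) ≤ r := r.cast_nonneg
  have stretch_eq : ENNReal.ofReal ((2 * (r : ℝ) + 1) * (α + 1) - 1)
      = 2 * r + (2 * r + 1) * ENNReal.ofReal α := by
    rw [show (2 * (r : ℝ) + 1) * (α + 1) - 1 = 2 * r + (2 * r + 1) * α by ring,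
      ENNReal.ofReal_add (by positivity) (by positivity),
      ENNReal.ofReal_mul (p := 2 * (r : ℝ) + 1) (by positivity),
      ENNReal.ofReal_add (by positivity) (by positivity), ENNReal.ofReal_mul (by positivity)]
    simp
  refine ⟨?_, wdist_le_mul_of_adj id ?_ (by finiteness) ?_⟩
  · intro a b hab
    rw [hS, SimpleGraph.fromEdgeSet_adj] at hab
    rcases hab.1 with h | ⟨K₁, K₂, hF₁₂, h⟩
    · obtain ⟨K, -, hK⟩ := Set.mem_iUnion₂.1 h
      exact K.tree_le hK
    · obtain ⟨u, v, huv, -, -, he⟩ := hemem K₁ K₂ (hFH hF₁₂)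
      rw [← SimpleGraph.mem_edgeSet, h, he]
      exact huv
  · rw [Ne, ENNReal.ofReal_eq_zero, not_le]
    nlinarith
  intro u v huv
  rw [stretch_eq]
  have hcover' : ∀ x, ∃ K : 𝒞, x ∈ K.1.carrier := fun x => by
    obtain ⟨K, hK, hx⟩ := Set.mem_iUnion₂.1 (hcover ▸ Set.mem_univ x)
    exact ⟨⟨K, hK⟩, hx⟩
  obtain ⟨K₁, hu⟩ := hcover' u
  obtain ⟨K₂, hv⟩ := hcover' v
  rcases eq_or_ne K₁ K₂ with rfl | hne
  · calc wdist S w u v ≤ (2 * r : ℕ) * (w s(u, v) : ENNReal) :=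
          (wdist_anti (tree_le K₁ K₁.2) w _ _).trans
            ((hsf K₁ K₁.2).wdist_le_of_mem (hrad K₁ K₁.2) huv hu hv)
      _ ≤ _ := by
          push_cast
          gcongr
          exact le_self_add
  · have hH₁₂ : H.Adj K₁ K₂ := (hH K₁ K₂).2 ⟨hne, u, v, huv, hu, hv⟩
    obtain ⟨h₁, h₂⟩ := root_le K₁ K₂ hne u v huv hu hv
    have hF₁₂ : wdist F wH K₁ K₂ ≤ ENNReal.ofReal α * (w s(u, v) : ENNReal) := by
      refine (hFα K₁ K₂).trans ?_
      gcongr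
      refine (wdist_le_of_adj wH hH₁₂).trans ?_
      rw [hwH K₁ K₂ hH₁₂]
      exact_mod_cast hemin K₁ K₂ hH₁₂ u v huv hu hv
    calc wdist S w u v
        ≤ wdist S w u K₁.1.root + (wdist S w K₁.1.root K₂.1.root + wdist S w K₂.1.root v) :=
          (wdist_triangle ..).trans (by gcongr; exact wdist_triangle ..)
      _ ≤ r * (w s(u, v) : ENNReal) + ((2 * r + 1) * (ENNReal.ofReal α * w s(u, v))
            + r * (w s(u, v) : ENNReal)) := by
          rw [wdist_comm S w K₂.1.root v]
          gcongr
          exact (roots_le K₁ K₂).trans (by gcongr)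
      _ = _ := by ring
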